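/- For every integer t ≥ 6 there exist real constants c, C > 0 and an integer N such that for every integer n ≥ N: (a) every K_3-saturated graph G on n vertices with minimum degree at least t, in which for every pair of distinct twin vertices there is a vertex of degree exactly t adjacent to both of them, satisfies e(G) ≥ t·n + c·n^{2/(t-3)}; and (b) there exists a K_3-saturated graph G on n vertices with minimum degree at least t, in which every pair of distinct twin vertices has a common neighbour of degree exactly t, satisfying e(G) ≤ t·n + C·n^{4/(t-1)}. -/

import Mathlib

open SimpleGraph

/-- `G` is `K_r`-saturated: `G` contains no `r`-clique, but adding any missing edge
creates an `r`-clique. -/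
def Ksat (r : ℕ) {V : Type*} (G : SimpleGraph V) : Prop :=
  G.CliqueFree r ∧ ∀ u v : V, u ≠ v → ¬ G.Adj u v →
    ¬ (G ⊔ fromEdgeSet {s(u, v)}).CliqueFree r

/-- `G` is twin-free: distinct vertices have distinct neighbourhoods. -/
def TwinFree {V : Type*} (G : SimpleGraph V) : Prop :=
  ∀ u v : V, G.neighborSet u = G.neighborSet v → u = v

/-- Minimum degree of `G` is at least `t`. -/
def MinDegGe {V : Type*} (G : SimpleGraph V) (t : ℕ) : Prop :=
  ∀ v : V, t ≤ (G.neighborSet v).ncard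

/-- Every pair of distinct twins has a common neighbour of degree exactly `t`. -/
def TwinCond {V : Type*} (G : SimpleGraph V) (t : ℕ) : Prop :=
  ∀ u v : V, u ≠ v → G.neighborSet u = G.neighborSet v →
    ∃ w : V, (G.neighborSet w).ncard = t ∧ G.Adj w u ∧ G.Adj w v

/-- An `(r,t)`-system. -/
def IsRTSystem (r t : ℕ) {V : Type*} [DecidableEq V] (H : SimpleGraph V)
    (F : Finset (Finset V)) : Prop :=
  H.CliqueFree r ∧
  (∀ S ∈ F, S.card = t ∧
    (H.induce (S : Set V)).CliqueFree (r - 1) ∧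
    ∀ v : V, v ∉ S → ¬ (H.induce ((insert v S : Finset V) : Set V)).CliqueFree (r - 1)) ∧
  (∀ S ∈ F, ∀ T ∈ F, S ≠ T → ¬ (H.induce ((S ∩ T : Finset V) : Set V)).CliqueFree (r - 2))

/-- A maximal `(r,t)`-system. -/
def IsMaxRTSystem (r t : ℕ) {V : Type*} [DecidableEq V] (H : SimpleGraph V)
    (F : Finset (Finset V)) : Prop :=
  IsRTSystem r t H F ∧
  ∀ u v : V, u ≠ v → ¬ H.Adj u v →
    ¬ (H ⊔ fromEdgeSet {s(u, v)}).CliqueFree r ∨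
    ∃ S ∈ F, ¬ (((H ⊔ fromEdgeSet {s(u, v)}).induce (S : Set V)).CliqueFree (r - 1))

/-- A `(3,t)`-system. -/
def Is3TSystem (t : ℕ) {V : Type*} [DecidableEq V] (H : SimpleGraph V)
    (F : Finset (Finset V)) : Prop :=
  H.CliqueFree 3 ∧
  (∀ S ∈ F, S.card = t ∧
    (∀ u ∈ S, ∀ v ∈ S, ¬ H.Adj u v) ∧
    (∀ v : V, v ∉ S → ∃ u ∈ S, H.Adj v u)) ∧
  (∀ S ∈ F, ∀ T ∈ F, S ≠ T → (S ∩ T).Nonempty)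

/-- A maximal `(3,t)`-system. -/
def IsMax3TSystem (t : ℕ) {V : Type*} [DecidableEq V] (H : SimpleGraph V)
    (F : Finset (Finset V)) : Prop :=
  Is3TSystem t H F ∧
  ∀ u v : V, u ≠ v → ¬ H.Adj u v →
    ¬ (H ⊔ fromEdgeSet {s(u, v)}).CliqueFree 3 ∨ ∃ S ∈ F, u ∈ S ∧ v ∈ S

noncomputable def s3 (t m : ℕ) : ℕ :=
  sSup {a : ℕ | ∃ (H : SimpleGraph (Fin m)) (F : Finset (Finset (Fin m))),
    Is3TSystem t H F ∧ F.card = a}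

noncomputable def ePrime (r t s : ℕ) : ℕ :=
  sInf {e : ℕ | ∃ (m : ℕ) (H : SimpleGraph (Fin m)) (F : Finset (Finset (Fin m))),
    IsMaxRTSystem r t H F ∧ F.card = s ∧ H.edgeSet.ncard = e}

noncomputable def e3min (t s : ℕ) : ℕ :=
  sInf {e : ℕ | ∃ (m : ℕ) (H : SimpleGraph (Fin m)) (F : Finset (Finset (Fin m))),
    Is3TSystem t H F ∧ F.card = s ∧ H.edgeSet.ncard = e}


section Saturation

/-- `G` has no triangle, phrased on vertices. -/
def TriangleFree {V : Type*} (G : SimpleGraph V) : Prop :=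
  ∀ a b c : V, G.Adj a b → G.Adj b c → ¬ G.Adj a c

/-- Distinct non-adjacent vertices have a common neighbour. -/
def CommonNbr {V : Type*} (G : SimpleGraph V) : Prop :=
  ∀ u v : V, u ≠ v → ¬ G.Adj u v → ∃ w, G.Adj u w ∧ G.Adj v w

theorem cliqueFree_three_iff {V : Type*} (G : SimpleGraph V) :
    G.CliqueFree 3 ↔ TriangleFree G := by
  classical
  constructor
  · intro h a b c hab hbc hac
    exact h {a, b, c} (is3Clique_triple_iff.2 ⟨hab, hac, hbc⟩)
  · intro h s hs
    obtain ⟨a, b, c, hab, hac, hbc, -⟩ := is3Clique_iff.1 hs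
    exact h a b c hab hbc hac

theorem ksat_three_iff {V : Type*} (G : SimpleGraph V) :
    Ksat 3 G ↔ TriangleFree G ∧ CommonNbr G := by
  classical
  unfold Ksat
  rw [cliqueFree_three_iff]
  refine and_congr_right fun hG => ?_
  simp only [cliqueFree_three_iff]
  constructor
  · intro h u v huv hadj
    have := h u v huv hadj
    simp only [TriangleFree, not_forall, not_not] at this
    obtain ⟨a, b, c, hab, hbc, hac⟩ := this
    have hab' := hG a b c
    simp only [sup_adj, fromEdgeSet_adj, Set.mem_singleton_iff, Sym2.eq_iff] at hab hbc hac
    grind [SimpleGraph.adj_comm, SimpleGraph.irrefl]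
  · intro h u v huv hadj hT
    obtain ⟨w, h1, h2⟩ := h u v huv hadj
    refine hT u w v ?_ ?_ ?_
    · exact Or.inl h1
    · exact Or.inl h2.symm
    · right; simp [huv]

end Saturation

section MaxIndep

open scoped Classical

variable {V : Type*}

/-- `S` is a maximal independent set of the subgraph of `G` induced on `W`. -/
def IsMaxIndepOn (G : SimpleGraph V) (W S : Finset V) : Prop :=
  S ⊆ W ∧ (∀ u ∈ S, ∀ v ∈ S, ¬ G.Adj u v) ∧ ∀ v ∈ W, v ∉ S → ∃ u ∈ S, G.Adj u v

/-- The maximal independent sets of size `b` of the subgraph induced on `W`. -/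
noncomputable def maxIndep (G : SimpleGraph V) (W : Finset V) (b : ℕ) : Finset (Finset V) :=
  (W.powersetCard b).filter (IsMaxIndepOn G W)

/-- The vertices of `W` outside the closed neighbourhood of `v`. -/
noncomputable def nonNbr (G : SimpleGraph V) (W : Finset V) (v : V) : Finset V :=
  W.filter fun w => w ≠ v ∧ ¬ G.Adj v w

/-- The number of neighbours of `v` in `W`. -/
noncomputable def degOn (G : SimpleGraph V) (W : Finset V) (v : V) : ℕ :=
  (W.filter fun w => G.Adj v w).card

variable {G : SimpleGraph V} {W : Finset V}

theorem mem_maxIndep {b : ℕ} {S : Finset V} :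
    S ∈ maxIndep G W b ↔ S.card = b ∧ IsMaxIndepOn G W S := by
  simp only [maxIndep, Finset.mem_filter, Finset.mem_powersetCard]
  exact ⟨fun h => ⟨h.1.2, h.2⟩, fun h => ⟨⟨h.2.1, h.1⟩, h.2⟩⟩

theorem erase_mem_maxIndep {b : ℕ} {S : Finset V} (hS : S ∈ maxIndep G W (b + 1)) {v : V}
    (hv : v ∈ S) : S.erase v ∈ maxIndep G (nonNbr G W v) b := by
  rw [mem_maxIndep] at *
  obtain ⟨hc, hSW, hind, hdom⟩ := hS
  refine ⟨by rw [Finset.card_erase_of_mem hv, hc]; rfl, ?_, ?_, ?_⟩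
  · intro w hw
    have hw' := Finset.mem_erase.1 hw
    simp only [nonNbr, Finset.mem_filter]
    exact ⟨hSW hw'.2, hw'.1, hind v hv w hw'.2⟩
  · intro u hu w hw
    exact hind u (Finset.mem_of_mem_erase hu) w (Finset.mem_of_mem_erase hw)
  · intro w hw hwS
    simp only [nonNbr, Finset.mem_filter] at hw
    have hwS' : w ∉ S := fun h => hwS (Finset.mem_erase.2 ⟨hw.2.1, h⟩)
    obtain ⟨u, hu, huw⟩ := hdom w hw.1 hwS'
    refine ⟨u, Finset.mem_erase.2 ⟨?_, hu⟩, huw⟩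
    rintro rfl
    exact hw.2.2 huw

theorem card_le_sum_maxIndep {b : ℕ} {F : Finset (Finset V)} (hF : F ⊆ maxIndep G W (b + 1))
    (A : Finset V) (hA : ∀ S ∈ F, ∃ v ∈ A, v ∈ S) :
    F.card ≤ ∑ v ∈ A, (maxIndep G (nonNbr G W v) b).card := by
  have hsub : F ⊆ A.biUnion fun v => (maxIndep G (nonNbr G W v) b).image (insert v) := by
    intro S hS
    obtain ⟨v, hvA, hvS⟩ := hA S hS
    simp only [Finset.mem_biUnion, Finset.mem_image]
    exact ⟨v, hvA, S.erase v, erase_mem_maxIndep (hF hS) hvS, Finset.insert_erase hvS⟩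
  refine (Finset.card_le_card hsub).trans (Finset.card_biUnion_le.trans ?_)
  exact Finset.sum_le_sum fun v _ => Finset.card_image_le

theorem nonNbr_subset (v : V) : nonNbr G W v ⊆ W := Finset.filter_subset _ _

theorem degOn_mono {W W' : Finset V} (h : W ⊆ W') (v : V) : degOn G W v ≤ degOn G W' v :=
  Finset.card_le_card (Finset.filter_subset_filter _ h)

theorem sum_degOn_mono {W W' : Finset V} (h : W ⊆ W') :
    ∑ v ∈ W, degOn G W v ≤ ∑ v ∈ W', degOn G W' v :=
  (Finset.sum_le_sum fun v _ => degOn_mono h v).trans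
    (Finset.sum_le_sum_of_subset h)

theorem IsMaxIndepOn.card_le {S : Finset V} (hS : IsMaxIndepOn G W S) :
    W.card ≤ ∑ v ∈ S, (degOn G W v + 1) := by
  classical
  have hsub : W ⊆ S.biUnion fun v => insert v (W.filter fun w => G.Adj v w) := by
    intro w hw
    simp only [Finset.mem_biUnion, Finset.mem_insert, Finset.mem_filter]
    by_cases hwS : w ∈ S
    · exact ⟨w, hwS, Or.inl rfl⟩
    · obtain ⟨u, hu, huw⟩ := hS.2.2 w hw hwS
      exact ⟨u, hu, Or.inr ⟨hw, huw⟩⟩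
  refine (Finset.card_le_card hsub).trans (Finset.card_biUnion_le.trans ?_)
  refine Finset.sum_le_sum fun v _ => (Finset.card_insert_le _ _).trans ?_
  unfold degOn
  apply le_of_eq
  congr!

/-- `{a, b, c}` is a maximal independent triple of the subgraph induced on `W`. -/
structure IsTriple (G : SimpleGraph V) (W : Finset V) (a b c : V) : Prop where
  mem₁ : a ∈ W
  mem₂ : b ∈ W
  mem₃ : c ∈ W
  ne₁₂ : a ≠ b
  ne₁₃ : a ≠ c
  ne₂₃ : b ≠ c
  nadj₁₂ : ¬ G.Adj a b
  nadj₁₃ : ¬ G.Adj a c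
  nadj₂₃ : ¬ G.Adj b c
  dom : ∀ d ∈ W, d ≠ a → d ≠ b → d ≠ c → G.Adj a d ∨ G.Adj b d ∨ G.Adj c d

theorem isTriple_of_mem {S : Finset V} (hS : S ∈ maxIndep G W 3) {u : V} (hu : u ∈ S) :
    ∃ v w, IsTriple G W u v w ∧ S = {u, v, w} := by
  rw [mem_maxIndep] at hS
  obtain ⟨hc, hSW, hind, hdom⟩ := hS
  have h2 : (S.erase u).card = 2 := by rw [Finset.card_erase_of_mem hu, hc]
  obtain ⟨v, w, hvw, hE⟩ := Finset.card_eq_two.1 h2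
  have hSe : S = {u, v, w} := by rw [← Finset.insert_erase hu, hE]
  have hv : v ∈ S.erase u := by simp [hE]
  have hw : w ∈ S.erase u := by simp [hE]
  rw [Finset.mem_erase] at hv hw
  refine ⟨v, w, ⟨hSW hu, hSW hv.2, hSW hw.2, hv.1.symm, hw.1.symm, hvw, hind _ hu _ hv.2,
    hind _ hu _ hw.2, hind _ hv.2 _ hw.2, ?_⟩, hSe⟩
  intro d hd h1 h2 h3
  obtain ⟨x, hx, hxd⟩ := hdom d hd (by simp [hSe, h1, h2, h3])
  rw [hSe] at hx
  simp only [Finset.mem_insert, Finset.mem_singleton] at hx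
  rcases hx with rfl | rfl | rfl <;> simp [hxd]

theorem IsTriple.swap {a b c : V} (h : IsTriple G W a b c) : IsTriple G W a c b :=
  ⟨h.1, h.3, h.2, h.5, h.4, h.6.symm, h.8, h.7, fun k => h.9 k.symm, fun d hd h1 h2 h3 => by
    have := h.10 d hd h1 h3 h2
    tauto⟩

theorem IsTriple.rotate {a b c : V} (h : IsTriple G W a b c) : IsTriple G W b a c :=
  ⟨h.2, h.1, h.3, h.4.symm, h.6, h.5, fun k => h.7 k.symm, h.9, h.8, fun d hd h1 h2 h3 => by
    have := h.10 d hd h2 h1 h3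
    tauto⟩

/-- At most two maximal independent triples contain two given vertices. -/
theorem card_triples_through_pair_le (hG : TriangleFree G) {u z : V} (huz : u ≠ z) :
    ((maxIndep G W 3).filter fun S => u ∈ S ∧ z ∈ S).card ≤ 2 := by
  by_contra! hlt
  obtain ⟨S₁, h1, S₂, h2, S₃, h3, h12, h13, h23⟩ := Finset.two_lt_card.1 hlt
  have key : ∀ S ∈ (maxIndep G W 3).filter fun S => u ∈ S ∧ z ∈ S,
      ∃ w, IsTriple G W u z w ∧ S = {u, z, w} := by
    intro S hS
    rw [Finset.mem_filter] at hS
    obtain ⟨v, w, ht, rfl⟩ := isTriple_of_mem hS.1 hS.2.1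
    have hz := hS.2.2
    simp only [Finset.mem_insert, Finset.mem_singleton] at hz
    rcases hz with rfl | rfl | rfl
    · exact absurd rfl huz
    · exact ⟨w, ht, rfl⟩
    · exact ⟨v, ht.swap, by rw [Finset.pair_comm]⟩
  obtain ⟨w₁, t1, rfl⟩ := key _ h1
  obtain ⟨w₂, t2, rfl⟩ := key _ h2
  obtain ⟨w₃, t3, rfl⟩ := key _ h3
  have adj : ∀ w w', IsTriple G W u z w → IsTriple G W u z w' → w ≠ w' → G.Adj w w' := by
    intro w w' t t' hne
    rcases t.dom w' t'.mem₃ t'.ne₁₃.symm t'.ne₂₃.symm hne.symm with h | h | h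
    · exact absurd h t'.nadj₁₃
    · exact absurd h t'.nadj₂₃
    · exact h
  have n12 : w₁ ≠ w₂ := by rintro rfl; exact h12 rfl
  have n13 : w₁ ≠ w₃ := by rintro rfl; exact h13 rfl
  have n23 : w₂ ≠ w₃ := by rintro rfl; exact h23 rfl
  exact hG _ _ _ (adj _ _ t1 t2 n12) (adj _ _ t2 t3 n23) (adj _ _ t1 t3 n13)

/-- A vertex in many maximal independent triples lies in one avoiding a given small set. -/
theorem exists_triple_avoiding (hG : TriangleFree G) {W₀ : Finset V} {u : V}
    (hu : 20 < ((maxIndep G W 3).filter fun S => S ⊆ W₀ ∧ u ∈ S).card)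
    (Z : Finset V) (hZ : Z.card ≤ 9) (huZ : u ∉ Z) :
    ∃ v w, IsTriple G W u v w ∧ v ∈ W₀ ∧ w ∈ W₀ ∧ v ∉ Z ∧ w ∉ Z := by
  by_contra! hno
  have hsub : ((maxIndep G W 3).filter fun S => S ⊆ W₀ ∧ u ∈ S) ⊆
      Z.biUnion fun z => (maxIndep G W 3).filter fun S => u ∈ S ∧ z ∈ S := by
    intro S hS
    rw [Finset.mem_filter] at hS
    obtain ⟨v, w, ht, rfl⟩ := isTriple_of_mem hS.1 hS.2.2
    have hv : v ∈ W₀ := hS.2.1 (by simp)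
    have hw : w ∈ W₀ := hS.2.1 (by simp)
    simp only [Finset.mem_biUnion, Finset.mem_filter]
    by_cases hvZ : v ∈ Z
    · exact ⟨v, hvZ, hS.1, by simp, by simp⟩
    · exact ⟨w, hno v w ht hv hw hvZ, hS.1, by simp, by simp⟩
  have h1 := (Finset.card_le_card hsub).trans
    (Finset.card_biUnion_le_card_mul Z _ 2 fun z hz =>
      card_triples_through_pair_le hG (by rintro rfl; exact huZ hz))
  omega

/-- If `u` has two disjoint completing pairs, no vertex outside them sees both vertices of one. -/
theorem IsTriple.not_adj_both (hG : TriangleFree G) {u v w v' w' x : V}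
    (h : IsTriple G W u v w) (h' : IsTriple G W u v' w') (hv : v' ≠ v ∧ v' ≠ w)
    (hw : w' ≠ v ∧ w' ≠ w) (hx : x ∈ W) (hxu : ¬ G.Adj u x) (hxv : G.Adj v x)
    (hxw : G.Adj w x) : ¬ (x ≠ u ∧ x ≠ v' ∧ x ≠ w') := by
  rintro ⟨h1, h2, h3⟩
  rcases h'.dom x hx h1 h2 h3 with k | k | k
  · exact hxu k
  · rcases h.dom v' h'.mem₂ h'.ne₁₂.symm hv.1 hv.2 with l | l | l
    · exact h'.nadj₁₂ l
    · exact hG _ _ _ l k hxv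
    · exact hG _ _ _ l k hxw
  · rcases h.dom w' h'.mem₃ h'.ne₁₃.symm hw.1 hw.2 with l | l | l
    · exact h'.nadj₁₃ l
    · exact hG _ _ _ l k hxv
    · exact hG _ _ _ l k hxw

/-- A vertex in many maximal independent triples, one of them `{u, v, w}`, has a further
completing pair which is joined to `{v, w}` by exactly a perfect matching. -/
theorem exists_matched_triple (hG : TriangleFree G) {W₀ : Finset V} {u v w : V}
    (hu : 20 < ((maxIndep G W 3).filter fun S => S ⊆ W₀ ∧ u ∈ S).card)
    (h : IsTriple G W u v w) (Z : Finset V) (hZ : Z.card ≤ 5) (huZ : u ∉ Z) :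
    ∃ v' w', IsTriple G W u v' w' ∧ v' ∈ W₀ ∧ w' ∈ W₀ ∧ v' ∉ Z ∧ w' ∉ Z ∧
      v' ≠ v ∧ v' ≠ w ∧ w' ≠ v ∧ w' ≠ w ∧
      G.Adj w v' ∧ G.Adj v w' ∧ ¬ G.Adj v v' ∧ ¬ G.Adj w w' := by
  obtain ⟨a, b, hab, ha, hb, haZ, hbZ⟩ := exists_triple_avoiding hG hu (insert v (insert w Z))
    ((Finset.card_insert_le _ _).trans (by have := Finset.card_insert_le w Z; omega))
    (by simp [h.ne₁₂, h.ne₁₃, huZ])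
  simp only [Finset.mem_insert, not_or] at haZ hbZ
  obtain ⟨c, d, hcd, -, -, hcZ, hdZ⟩ := exists_triple_avoiding hG hu {v, w, a, b}
    (Finset.card_le_four.trans (by norm_num))
    (by simp [h.ne₁₂, h.ne₁₃, hab.ne₁₂, hab.ne₁₃])
  simp only [Finset.mem_insert, Finset.mem_singleton, not_or] at hcZ hdZ
  have na : ¬ (G.Adj v a ∧ G.Adj w a) := fun k =>
    h.not_adj_both hG hcd ⟨hcZ.1, hcZ.2.1⟩ ⟨hdZ.1, hdZ.2.1⟩ hab.mem₂ hab.nadj₁₂ k.1 k.2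
      ⟨hab.ne₁₂.symm, Ne.symm hcZ.2.2.1, Ne.symm hdZ.2.2.1⟩
  have nb : ¬ (G.Adj v b ∧ G.Adj w b) := fun k =>
    h.not_adj_both hG hcd ⟨hcZ.1, hcZ.2.1⟩ ⟨hdZ.1, hdZ.2.1⟩ hab.mem₃ hab.nadj₁₃ k.1 k.2
      ⟨hab.ne₁₃.symm, Ne.symm hcZ.2.2.2, Ne.symm hdZ.2.2.2⟩
  have da := h.dom a hab.mem₂ hab.ne₁₂.symm haZ.1 haZ.2.1
  have dv := hab.dom v h.mem₂ h.ne₁₂.symm (Ne.symm haZ.1) (Ne.symm hbZ.1)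
  have dw := hab.dom w h.mem₃ h.ne₁₃.symm (Ne.symm haZ.2.1) (Ne.symm hbZ.2.1)
  rw [G.adj_comm a v, G.adj_comm b v] at dv
  rw [G.adj_comm a w, G.adj_comm b w] at dw
  by_cases hva : G.Adj v a
  · have hwa : ¬ G.Adj w a := fun k => na ⟨hva, k⟩
    have hwb : G.Adj w b := (dw.resolve_left h.nadj₁₃).resolve_left hwa
    exact ⟨b, a, hab.swap, hb, ha, hbZ.2.2, haZ.2.2, hbZ.1, hbZ.2.1, haZ.1, haZ.2.1,
      hwb, hva, fun k => nb ⟨k, hwb⟩, hwa⟩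
  · have hvb : G.Adj v b := (dv.resolve_left h.nadj₁₂).resolve_left hva
    have hwa : G.Adj w a := (da.resolve_left hab.nadj₁₂).resolve_left hva
    exact ⟨a, b, hab, ha, hb, haZ.2.2, hbZ.2.2, haZ.1, haZ.2.1, hbZ.1, hbZ.2.1,
      hwa, hvb, hva, fun k => nb ⟨hvb, k⟩⟩

theorem exists_vertex_in_few_triples (hG : TriangleFree G) {W₀ : Finset V}
    (hne : W₀.Nonempty) :
    ∃ u ∈ W₀, ((maxIndep G W 3).filter fun S => S ⊆ W₀ ∧ u ∈ S).card ≤ 20 := by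
  by_contra! hdeg
  obtain ⟨u, hu⟩ := hne
  obtain ⟨v₁, w₁, h1, hv1, hw1, -, -⟩ := exists_triple_avoiding hG (hdeg u hu) ∅ (by simp) (by simp)
  obtain ⟨v₂, w₂, h2, hv2, hw2, -, -, a1, a2, a3, a4, a5, a6, a7, a8⟩ :=
    exists_matched_triple hG (hdeg u hu) h1 ∅ (by simp) (by simp)
  obtain ⟨v₃, w₃, h3, hv3, hw3, b9, b0, b1, b2, b3, b4, b5, b6, b7, b8⟩ :=
    exists_matched_triple hG (hdeg u hu) h1 {v₂, w₂} (Finset.card_le_two.trans (by norm_num))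
      (by simp [h2.ne₁₂, h2.ne₁₃])
  simp only [Finset.mem_insert, Finset.mem_singleton, not_or] at b9 b0
  obtain ⟨p, q, h4, hp, hq, c9, c0, c1, c2, c3, c4, c5, c6, c7, c8⟩ :=
    exists_matched_triple hG (hdeg v₁ hv1) h1.rotate {v₂, w₂, v₃, w₃}
      (Finset.card_le_four.trans (by norm_num))
      (by simp [Ne.symm a1, Ne.symm a3, Ne.symm b1, Ne.symm b3])
  simp only [Finset.mem_insert, Finset.mem_singleton, not_or] at c9 c0
  have q2 : G.Adj q v₂ := by
    rcases h4.dom v₂ h2.mem₂ a1 (Ne.symm c9.1) (Ne.symm c0.1) with k | k | k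
    · exact absurd k a7
    · exact absurd a5 (hG _ _ _ c5 k)
    · exact k
  have q3 : G.Adj q v₃ := by
    rcases h4.dom v₃ h3.mem₂ b1 (Ne.symm c9.2.2.1) (Ne.symm c0.2.2.1) with k | k | k
    · exact absurd k b7
    · exact absurd b5 (hG _ _ _ c5 k)
    · exact k
  have w23 : G.Adj v₃ w₂ := by
    rcases h3.dom w₂ h2.mem₃ h2.ne₁₃.symm (Ne.symm b9.2) (Ne.symm b0.2) with k | k | k
    · exact absurd k h2.nadj₁₃
    · exact k
    · exact absurd a6 (hG _ _ _ b6 k)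
  have wq : ¬ G.Adj q w₂ := hG _ _ _ q3 w23
  have wp : G.Adj p w₂ := by
    rcases h2.dom p h4.mem₂ c1 c9.1 c9.2.1 with k | k | k
    · exact absurd k c7
    · exact absurd c5 (hG _ _ _ a5 k)
    · exact k.symm
  obtain ⟨a, b, h5, -, -, d1, d2⟩ := exists_triple_avoiding hG (hdeg q hq) {v₁, p, w₂}
    (Finset.card_le_three.trans (by norm_num)) (by simp [h4.ne₁₃.symm, h4.ne₂₃.symm, c0.2.1])
  simp only [Finset.mem_insert, Finset.mem_singleton, not_or] at d1 d2
  exact h4.swap.rotate.not_adj_both hG h5 ⟨d1.1, d1.2.1⟩ ⟨d2.1, d2.2.1⟩ h2.mem₃ wq a6 wp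
    ⟨Ne.symm c0.2.1, Ne.symm d1.2.2, Ne.symm d2.2.2⟩

theorem card_maxIndep_three_le (hG : TriangleFree G) (W : Finset V) :
    (maxIndep G W 3).card ≤ 20 * W.card := by
  suffices h : ∀ W₀ : Finset V,
      ((maxIndep G W 3).filter fun S => S ⊆ W₀).card ≤ 20 * W₀.card by
    have h' := h W
    rwa [Finset.filter_true_of_mem] at h'
    intro S hS
    exact (mem_maxIndep.1 hS).2.1
  intro W₀
  induction hn : W₀.card generalizing W₀ with
  | zero =>
    rw [Finset.card_eq_zero] at hn
    subst hn
    simp only [mul_zero, nonpos_iff_eq_zero, Finset.card_eq_zero, Finset.filter_eq_empty_iff]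
    intro S hS hS0
    have := (mem_maxIndep.1 hS).1
    rw [Finset.subset_empty.1 hS0] at this
    simp at this
  | succ n ih =>
    obtain ⟨u, hu, hcard⟩ := exists_vertex_in_few_triples (W := W) hG
      (Finset.card_pos.1 (by omega : 0 < W₀.card))
    have hsub : ((maxIndep G W 3).filter fun S => S ⊆ W₀) ⊆
        ((maxIndep G W 3).filter fun S => S ⊆ W₀ ∧ u ∈ S) ∪
        ((maxIndep G W 3).filter fun S => S ⊆ W₀.erase u) := by
      intro S hS
      rw [Finset.mem_filter] at hS
      by_cases huS : u ∈ S
      · simp [hS, huS]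
      · simp [hS, huS, Finset.subset_erase]
    have h1 := (Finset.card_le_card hsub).trans (Finset.card_union_le _ _)
    have h2 := ih (W₀.erase u) (by rw [Finset.card_erase_of_mem hu, hn]; rfl)
    omega

theorem card_maxIndep_le_pow (hG : TriangleFree G) (b : ℕ) (W : Finset V) :
    (maxIndep G W (b + 3)).card ≤ 20 * W.card ^ (b + 1) := by
  induction b generalizing W with
  | zero => simpa using card_maxIndep_three_le hG W
  | succ b ih =>
    refine (card_le_sum_maxIndep (b := b + 3) subset_rfl W ?_).trans ?_
    · intro S hS
      obtain ⟨hc, hS'⟩ := mem_maxIndep.1 hS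
      obtain ⟨v, hv⟩ := Finset.card_pos.1 (by omega : 0 < S.card)
      exact ⟨v, hS'.1 hv, hv⟩
    · calc _ ≤ ∑ v ∈ W, 20 * W.card ^ (b + 1) := by
            refine Finset.sum_le_sum fun v _ => (ih _).trans ?_
            gcongr
            exact nonNbr_subset v
        _ = 20 * W.card ^ (b + 1 + 1) := by
            rw [Finset.sum_const, smul_eq_mul]; ring

/-- A maximal independent set of size `k` in a large graph has a vertex of large degree. -/
theorem exists_large_degOn {k : ℕ} {S : Finset V} (hS : S ∈ maxIndep G W k)
    (hW : 2 * k < W.card) : ∃ v ∈ W.filter fun v => W.card ≤ 2 * k * degOn G W v, v ∈ S := by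
  obtain ⟨hc, hS⟩ := mem_maxIndep.1 hS
  by_contra! hno
  have hlt : ∀ v ∈ S, 2 * k * degOn G W v ≤ W.card := by
    intro v hv
    by_contra! h
    exact hno v (Finset.mem_filter.2 ⟨hS.1 hv, h.le⟩) hv
  have h1 := hS.card_le
  have h2 : ∑ v ∈ S, 2 * k * (degOn G W v + 1) ≤ ∑ v ∈ S, (W.card + 2 * k) :=
    Finset.sum_le_sum fun v hv => by have := hlt v hv; rw [mul_add, mul_one]; omega
  rw [← Finset.mul_sum, Finset.sum_const, hc, smul_eq_mul] at h2
  have h3 : 2 * k * W.card ≤ k * (W.card + 2 * k) := (Nat.mul_le_mul_left _ h1).trans h2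
  rcases Nat.eq_zero_or_pos k with rfl | hk
  · simp only [Finset.card_eq_zero] at hc
    subst hc
    simp at h1
    simp [h1] at hW
  · nlinarith

/-- In a triangle-free graph with at most `q ^ 2 / 2` edges there are `O(q ^ (b + 2))` maximal
independent sets of size `b + 4`. -/
theorem exists_card_maxIndep_le (b : ℕ) :
    ∃ C : ℕ, ∀ (V : Type) (G : SimpleGraph V), TriangleFree G →
      ∀ (W : Finset V) (q : ℕ), 1 ≤ q → ∑ v ∈ W, degOn G W v ≤ q ^ 2 →
        (maxIndep G W (b + 4)).card ≤ C * q ^ (b + 2) := by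
  have small : ∀ (b : ℕ) (V : Type) (G : SimpleGraph V), TriangleFree G →
      ∀ (W : Finset V) (q : ℕ), W.card ≤ 2 * (b + 4) * q →
        (maxIndep G W (b + 4)).card ≤ 20 * (2 * (b + 4)) ^ (b + 2) * q ^ (b + 2) := by
    intro b V G hG W q hW
    refine (card_maxIndep_le_pow hG (b + 1) W).trans ?_
    rw [mul_assoc, ← mul_pow]
    gcongr
  have large : ∀ (b : ℕ) (V : Type) (G : SimpleGraph V) (W : Finset V) (q : ℕ),
      1 ≤ q → ∑ v ∈ W, degOn G W v ≤ q ^ 2 → 2 * (b + 4) * q < W.card →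
      ∃ A : Finset V, A.card * W.card ≤ 2 * (b + 4) * q ^ 2 ∧
        (maxIndep G W (b + 4)).card ≤ ∑ v ∈ A, (maxIndep G (nonNbr G W v) (b + 3)).card := by
    intro b V G W q hq hσ hW
    refine ⟨W.filter fun v => W.card ≤ 2 * (b + 4) * degOn G W v, ?_,
      card_le_sum_maxIndep subset_rfl _ fun S hS => exists_large_degOn hS (by nlinarith)⟩
    calc _ = ∑ v ∈ W.filter (fun v => W.card ≤ 2 * (b + 4) * degOn G W v), W.card := by simp
      _ ≤ ∑ v ∈ W.filter (fun v => W.card ≤ 2 * (b + 4) * degOn G W v),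
            2 * (b + 4) * degOn G W v :=
          Finset.sum_le_sum fun v hv => (Finset.mem_filter.1 hv).2
      _ ≤ ∑ v ∈ W, 2 * (b + 4) * degOn G W v :=
          Finset.sum_le_sum_of_subset (Finset.filter_subset _ _)
      _ ≤ _ := by rw [← Finset.mul_sum]; gcongr
  induction b with
  | zero =>
    refine ⟨20 * (2 * (0 + 4)) ^ (0 + 2), fun V G hG W q hq hσ => ?_⟩
    rcases le_or_gt W.card (2 * (0 + 4) * q) with hW | hW
    · exact small 0 V G hG W q hW
    · obtain ⟨A, hA, hcard⟩ := large 0 V G W q hq hσ hW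
      refine hcard.trans ((Finset.sum_le_sum fun v _ => (card_maxIndep_three_le hG _).trans
        (Nat.mul_le_mul_left 20 (Finset.card_le_card (nonNbr_subset v)))).trans ?_)
      rw [Finset.sum_const, smul_eq_mul]
      norm_num at hA ⊢
      nlinarith
  | succ b ih =>
    obtain ⟨C, hC⟩ := ih
    refine ⟨20 * (2 * (b + 1 + 4)) ^ (b + 1 + 2) + C, fun V G hG W q hq hσ => ?_⟩
    rw [add_mul]
    rcases le_or_gt W.card (2 * (b + 1 + 4) * q) with hW | hW
    · exact (small (b + 1) V G hG W q hW).trans (Nat.le_add_right _ _)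
    · obtain ⟨A, hA, hcard⟩ := large (b + 1) V G W q hq hσ hW
      have hAq : A.card ≤ q := by
        have h1 : A.card * (2 * (b + 1 + 4) * q) ≤ q * (2 * (b + 1 + 4) * q) :=
          (Nat.mul_le_mul_left _ hW.le).trans (hA.trans (le_of_eq (by ring)))
        exact Nat.le_of_mul_le_mul_right h1 (by positivity)
      refine hcard.trans ((Finset.sum_le_sum fun v _ => hC V G hG _ q hq
        ((sum_degOn_mono (nonNbr_subset v)).trans hσ)).trans ?_)
      rw [Finset.sum_const, smul_eq_mul]
      calc A.card * (C * q ^ (b + 2)) ≤ q * (C * q ^ (b + 2)) := by gcongr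
        _ = C * q ^ (b + 1 + 2) := by ring
        _ ≤ _ := Nat.le_add_left _ _

end MaxIndep

section BoundedCore

open scoped Classical

/-- Let `W` be a set of vertices of degree less than `K` that are all joined to all of `T`. Up to a
bounded set `X`, the vertices of `W` are only joined to vertices of degree at least `K`, and every
vertex outside `X` has more than `t` neighbours in `X` or no neighbour in `W \ X`. -/
theorem exists_core (K t k : ℕ) :
    ∃ C : ℕ, ∀ (V : Type) [Fintype V] (G : SimpleGraph V), TriangleFree G → CommonNbr G →
      ∀ T W : Finset V, (∀ w ∈ W, (G.neighborFinset w).card < K ∧ ∀ a ∈ T, G.Adj w a) →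
        K ≤ T.card + k →
        ∃ X : Finset V, X.card ≤ C ∧
          (∀ z ∈ W, z ∉ X → ∀ y, G.Adj z y → K ≤ (G.neighborFinset y).card) ∧
          ∀ b, b ∉ X → t + 1 ≤ degOn G X b ∨ ∀ z ∈ W, z ∉ X → ¬ G.Adj b z := by
  induction k with
  | zero =>
    refine ⟨0, fun V _ G _ _ T W hW hK => ⟨∅, by simp, ?_, ?_⟩⟩
    all_goals
      have hW0 : ∀ z, z ∉ W := by
        intro z hz
        obtain ⟨h1, h2⟩ := hW z hz
        have : T.card ≤ (G.neighborFinset z).card :=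
          Finset.card_le_card fun a ha => by simpa using h2 a ha
        omega
    · exact fun z hz => absurd hz (hW0 z)
    · exact fun b _ => Or.inr fun z hz => absurd hz (hW0 z)
  | succ k ih =>
    obtain ⟨C, hC⟩ := ih
    refine ⟨(K + 1 + t) + (K + t * K) * C + (t + 1) * (K + 1),
      fun V _ G hG hN T W hW hK => ?_⟩
    have branch : ∀ D R : Finset V, (∀ d ∈ D, d ∉ T) → D.card ≤ K + t * K → R.card ≤ K + 1 + t →
        (∀ w ∈ W, w ∉ R → ∃ d ∈ D, G.Adj w d) →
        ∃ X : Finset V, X.card ≤ (K + 1 + t) + (K + t * K) * C + (t + 1) * (K + 1) ∧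
          (∀ z ∈ W, z ∉ X → ∀ y, G.Adj z y → K ≤ (G.neighborFinset y).card) ∧
          ∀ b, b ∉ X → t + 1 ≤ degOn G X b ∨ ∀ z ∈ W, z ∉ X → ¬ G.Adj b z := by
      intro D R hDT hD hR hcov
      have hX : ∀ d : V, ∃ X : Finset V, d ∈ D → X.card ≤ C ∧
          (∀ z ∈ W.filter (fun w => G.Adj w d), z ∉ X →
            ∀ y, G.Adj z y → K ≤ (G.neighborFinset y).card) ∧
          ∀ b, b ∉ X → t + 1 ≤ degOn G X b ∨
            ∀ z ∈ W.filter (fun w => G.Adj w d), z ∉ X → ¬ G.Adj b z := by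
        intro d
        by_cases hd : d ∈ D
        · obtain ⟨X, h⟩ := hC V G hG hN (insert d T) (W.filter fun w => G.Adj w d)
            (by
              intro w hw
              rw [Finset.mem_filter] at hw
              refine ⟨(hW w hw.1).1, fun a ha => ?_⟩
              rcases Finset.mem_insert.1 ha with rfl | ha
              · exact hw.2
              · exact (hW w hw.1).2 a ha)
            (by rw [Finset.card_insert_of_notMem (hDT d hd)]; omega)
          exact ⟨X, fun _ => h⟩
        · exact ⟨∅, fun h => absurd h hd⟩
      choose X hX using hX
      have hsub : ∀ d ∈ D, X d ⊆ R ∪ D.biUnion X := fun d hd x hx =>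
        Finset.mem_union_right _ (Finset.mem_biUnion.2 ⟨d, hd, hx⟩)
      refine ⟨R ∪ D.biUnion X, ?_, ?_, ?_⟩
      · have h1 := Finset.card_union_le R (D.biUnion X)
        have h2 := Finset.card_biUnion_le_card_mul D X C fun d hd => (hX d hd).1
        have h3 : D.card * C ≤ (K + t * K) * C := Nat.mul_le_mul_right _ hD
        omega
      · intro z hz hzX y hzy
        obtain ⟨d, hd, hzd⟩ := hcov z hz fun h => hzX (Finset.mem_union_left _ h)
        exact (hX d hd).2.1 z (Finset.mem_filter.2 ⟨hz, hzd⟩) (fun h => hzX (hsub d hd h)) y hzy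
      · intro b hb
        by_cases hdeg : ∃ d ∈ D, t + 1 ≤ degOn G (X d) b
        · obtain ⟨d, hd, h⟩ := hdeg
          exact Or.inl (h.trans (degOn_mono (hsub d hd) b))
        · right
          intro z hz hzX
          obtain ⟨d, hd, hzd⟩ := hcov z hz fun h => hzX (Finset.mem_union_left _ h)
          refine ((hX d hd).2.2 b fun h => hb (hsub d hd h)).resolve_left
            (fun h => hdeg ⟨d, hd, h⟩) z (Finset.mem_filter.2 ⟨hz, hzd⟩)
            fun h => hzX (hsub d hd h)
    by_cases hlow : ∃ z ∈ W, ∃ y, G.Adj z y ∧ (G.neighborFinset y).card < K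
    · obtain ⟨z, hz, y, hzy, hy⟩ := hlow
      refine branch (G.neighborFinset y) (insert y (G.neighborFinset y)) ?_ (by omega)
        ((Finset.card_insert_le _ _).trans (by omega)) ?_
      · intro d hd hdT
        rw [mem_neighborFinset] at hd
        exact hG _ _ _ hzy hd ((hW z hz).2 d hdT)
      · intro w hw hwR
        simp only [Finset.mem_insert, mem_neighborFinset, not_or] at hwR
        obtain ⟨d, h1, h2⟩ := hN y w (Ne.symm hwR.1) hwR.2
        exact ⟨d, by simpa using h1, h2⟩
    · push Not at hlow
      let P : Finset V → Prop := fun Z => ∀ z ∈ Z, ∀ z' ∈ Z, z ≠ z' →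
        G.neighborFinset z ∩ G.neighborFinset z' ⊆ T
      have nbrs_card : ∀ Z ⊆ W, (Z.biUnion fun z => G.neighborFinset z).card ≤ Z.card * K :=
        fun Z hZ => Finset.card_biUnion_le_card_mul _ _ _ fun z hz => (hW z (hZ hz)).1.le
      by_cases hbig : ∃ Z ⊆ W, P Z ∧ Z.card = t + 1
      · obtain ⟨Z, hZW, hP, hZ⟩ := hbig
        refine ⟨Z ∪ Z.biUnion fun z => G.neighborFinset z, ?_, fun z hz _ => hlow z hz, ?_⟩
        · have h1 := Finset.card_union_le Z (Z.biUnion fun z => G.neighborFinset z)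
          have h2 := nbrs_card Z hZW
          rw [hZ] at h1 h2
          have : (t + 1) * (K + 1) = (t + 1) * K + (t + 1) := by ring
          omega
        · intro b hb
          simp only [Finset.mem_union, Finset.mem_biUnion, mem_neighborFinset, not_or,
            not_exists, not_and] at hb
          by_cases hbT : ∃ a ∈ T, G.Adj b a
          · obtain ⟨a, ha, hba⟩ := hbT
            exact Or.inr fun z hz _ hbz => hG _ _ _ hbz ((hW z hz).2 a ha) hba
          · left
            push Not at hbT
            have hc : ∀ z ∈ Z, ∃ w, G.Adj z w ∧ G.Adj b w := fun z hz =>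
              hN z b (by rintro rfl; exact hb.1 hz) (hb.2 z hz)
            choose! f hf using hc
            rw [← hZ, degOn]
            refine Finset.card_le_card_of_injOn f ?_ ?_
            · intro z hz
              simp only [Finset.coe_filter, Set.mem_ofPred_eq, Finset.mem_union,
                Finset.mem_biUnion, mem_neighborFinset]
              exact ⟨Or.inr ⟨z, hz, (hf z hz).1⟩, (hf z hz).2⟩
            · intro z hz z' hz' heq
              by_contra hne
              have hm : f z ∈ G.neighborFinset z ∩ G.neighborFinset z' := by
                simp only [Finset.mem_inter, mem_neighborFinset]
                exact ⟨(hf z hz).1, by rw [heq]; exact (hf z' hz').1⟩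
              exact hbT _ (hP z hz z' hz' hne hm) (hf z hz).2
      · have hsmall : ∀ Z ⊆ W, P Z → Z.card ≤ t := by
          intro Z hZW hP
          by_contra! h
          obtain ⟨Z', hZ', hc⟩ := Finset.exists_subset_card_eq (show t + 1 ≤ Z.card from h)
          exact hbig ⟨Z', hZ'.trans hZW, fun z hz z' hz' => hP z (hZ' hz) z' (hZ' hz'), hc⟩
        obtain ⟨Z, hZ, hmax⟩ := Finset.exists_max_image (W.powerset.filter P) Finset.card
          ⟨∅, by simp [P]⟩
        rw [Finset.mem_filter, Finset.mem_powerset] at hZ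
        have hZt := hsmall Z hZ.1 hZ.2
        refine branch ((Z.biUnion fun z => G.neighborFinset z) \ T) Z
          (fun d hd => (Finset.mem_sdiff.1 hd).2) ?_ (by omega) ?_
        · have h1 := Finset.card_le_card
            (Finset.sdiff_subset (s := Z.biUnion fun z => G.neighborFinset z) (t := T))
          have h2 := nbrs_card Z hZ.1
          have h3 : Z.card * K ≤ t * K := Nat.mul_le_mul_right _ hZt
          omega
        · intro w hw hwZ
          by_contra! hno
          have hP : P (insert w Z) := by
            have hd : ∀ z ∈ Z, G.neighborFinset w ∩ G.neighborFinset z ⊆ T := by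
              intro z hz a ha
              simp only [Finset.mem_inter, mem_neighborFinset] at ha
              by_contra haT
              refine hno a (Finset.mem_sdiff.2 ⟨Finset.mem_biUnion.2 ⟨z, hz, ?_⟩, haT⟩) ha.1
              simpa using ha.2
            intro z hz z' hz' hne
            rcases Finset.mem_insert.1 hz with rfl | hz1 <;>
              rcases Finset.mem_insert.1 hz' with rfl | hz1'
            · exact absurd rfl hne
            · exact hd _ hz1'
            · rw [Finset.inter_comm]; exact hd _ hz1
            · exact hZ.2 z hz1 z' hz1' hne
          have := hmax (insert w Z) (Finset.mem_filter.2
            ⟨Finset.mem_powerset.2 (Finset.insert_subset hw hZ.1), hP⟩)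
          rw [Finset.card_insert_of_notMem hwZ] at this
          omega

end BoundedCore

section LowerBound

open scoped Classical

variable {V : Type} {G : SimpleGraph V}

theorem sum_degOn_comm (A B : Finset V) :
    ∑ a ∈ A, degOn G B a = ∑ b ∈ B, degOn G A b := by
  have := Finset.sum_card_bipartiteAbove_eq_sum_card_bipartiteBelow (s := A) (t := B) G.Adj
  simp only [Finset.bipartiteAbove, Finset.bipartiteBelow] at this
  unfold degOn
  rw [this]
  exact Finset.sum_congr rfl fun b _ => by simp only [G.adj_comm]

/-- If every vertex of `H \ X` has more than `t` neighbours in `X` or at least `2 * t + 2`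
neighbours in `H`, then `H` spans about `(t + 1) * |H|` edges at least. -/
theorem card_mul_le_sum_degOn {H X : Finset V} (hXH : X ⊆ H) (t : ℕ)
    (h : ∀ b ∈ H, b ∉ X → t + 1 ≤ degOn G X b ∨ 2 * t + 2 ≤ degOn G H b) :
    (2 * t + 2) * H.card ≤ ∑ b ∈ H, degOn G H b + (2 * t + 2) * X.card := by
  set B₁ := (H \ X).filter fun b => t + 1 ≤ degOn G X b with hB₁
  set B₂ := (H \ X).filter fun b => ¬ t + 1 ≤ degOn G X b with hB₂
  have hB₁H : B₁ ⊆ H := (Finset.filter_subset _ _).trans Finset.sdiff_subset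
  have hcard : H.card = B₁.card + B₂.card + X.card := by
    rw [hB₁, hB₂, Finset.card_filter_add_card_filter_not, Finset.card_sdiff_add_card_eq_card hXH]
  have hsum : ∑ b ∈ H, degOn G H b =
      ∑ b ∈ B₁, degOn G H b + ∑ b ∈ B₂, degOn G H b + ∑ b ∈ X, degOn G H b := by
    rw [hB₁, hB₂, Finset.sum_filter_add_sum_filter_not, Finset.sum_sdiff hXH]
  have s1' : B₁.card * (t + 1) ≤ ∑ b ∈ B₁, degOn G X b := by
    rw [← smul_eq_mul, ← Finset.sum_const]
    exact Finset.sum_le_sum fun b hb => (Finset.mem_filter.1 hb).2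
  have s1 : B₁.card * (t + 1) ≤ ∑ b ∈ B₁, degOn G H b :=
    s1'.trans (Finset.sum_le_sum fun b _ => degOn_mono hXH b)
  have s2 : B₂.card * (2 * t + 2) ≤ ∑ b ∈ B₂, degOn G H b := by
    rw [← smul_eq_mul, ← Finset.sum_const]
    refine Finset.sum_le_sum fun b hb => ?_
    rw [hB₂, Finset.mem_filter, Finset.mem_sdiff] at hb
    exact (h b hb.1.1 hb.1.2).resolve_left hb.2
  have s3 : B₁.card * (t + 1) ≤ ∑ b ∈ X, degOn G H b := by
    refine s1'.trans ?_
    rw [sum_degOn_comm]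
    exact Finset.sum_le_sum fun b _ => degOn_mono hB₁H b
  rw [hcard, hsum]
  nlinarith

variable [Fintype V]

theorem degOn_eq_card_of_subset {H : Finset V} {z : V} (h : ∀ y, G.Adj z y → y ∈ H) :
    degOn G H z = (G.neighborFinset z).card := by
  unfold degOn
  congr 1
  ext y
  simp only [Finset.mem_filter, mem_neighborFinset]
  exact ⟨fun k => k.2, fun k => ⟨h y k, k⟩⟩

/-- Edge count when the complement of `H` is independent. -/
theorem two_mul_edges_eq {H : Finset V} (hH : ∀ z, z ∉ H → ∀ y, G.Adj z y → y ∈ H) :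
    2 * G.edgeSet.ncard =
      ∑ h ∈ H, degOn G H h + 2 * ∑ z ∈ Hᶜ, (G.neighborFinset z).card := by
  have h1 : G.edgeSet.ncard = G.edgeFinset.card := by
    rw [← coe_edgeFinset, Set.ncard_coe_finset]
  have h2 := G.sum_degrees_eq_twice_card_edges
  have h3 : ∀ v, G.degree v = degOn G H v + degOn G Hᶜ v := by
    intro v
    rw [← card_neighborFinset_eq_degree, degOn, degOn, ← Finset.card_union_of_disjoint]
    · congr 1
      ext y
      simp only [mem_neighborFinset, Finset.mem_union, Finset.mem_filter, Finset.mem_compl]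
      tauto
    · exact Finset.disjoint_filter_filter disjoint_compl_right
  have h4 : ∑ h ∈ H, degOn G Hᶜ h = ∑ z ∈ Hᶜ, (G.neighborFinset z).card := by
    rw [sum_degOn_comm]
    exact Finset.sum_congr rfl fun z hz => degOn_eq_card_of_subset (hH z (Finset.mem_compl.1 hz))
  rw [h1, ← h2, ← Finset.sum_add_sum_compl H, Finset.sum_congr rfl fun v _ => h3 v,
    Finset.sum_add_distrib, h4]
  have h5 : ∑ z ∈ Hᶜ, G.degree z = ∑ z ∈ Hᶜ, (G.neighborFinset z).card :=
    Finset.sum_congr rfl fun z _ => (card_neighborFinset_eq_degree ..).symm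
  omega

/-- Twin classes have at most `t` members. -/
theorem card_le_mul_card_nbrs {t : ℕ} (ht : 1 ≤ t) (hT : TwinCond G t) (A : Finset V) :
    A.card ≤ t * (A.image fun z => G.neighborFinset z).card := by
  refine Finset.card_le_mul_card_image A t fun S hS => ?_
  rcases le_or_gt ((A.filter fun z => G.neighborFinset z = S).card) 1 with h | h
  · exact h.trans ht
  · obtain ⟨u, hu, v, hv, huv⟩ := Finset.one_lt_card.1 h
    rw [Finset.mem_filter] at hu hv
    have hset : ∀ a b : V, G.neighborFinset a = G.neighborFinset b →
        G.neighborSet a = G.neighborSet b := by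
      intro a b hab
      ext x
      simpa only [mem_neighborFinset, mem_neighborSet] using Finset.ext_iff.1 hab x
    obtain ⟨w, hw, hwu, -⟩ := hT u v huv (hset u v (hu.2.trans hv.2.symm))
    rw [← coe_neighborFinset, Set.ncard_coe_finset] at hw
    rw [← hw]
    refine Finset.card_le_card fun z hz => ?_
    rw [Finset.mem_filter] at hz
    have : w ∈ G.neighborFinset z := by
      rw [hz.2, ← hu.2, mem_neighborFinset]; exact hwu.symm
    rw [mem_neighborFinset] at this ⊢
    exact this.symm

/-- The neighbourhood of a vertex all of whose neighbours lie in `H` is maximal independent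
in `H`. -/
theorem neighborFinset_mem_maxIndep (hG : TriangleFree G) (hN : CommonNbr G) {H : Finset V}
    {z : V} (hz : z ∉ H) (hH : ∀ y, G.Adj z y → y ∈ H) {t : ℕ}
    (hd : (G.neighborFinset z).card = t) : G.neighborFinset z ∈ maxIndep G H t := by
  rw [mem_maxIndep]
  refine ⟨hd, fun y hy => hH y (by simpa using hy), fun u hu v hv huv => ?_, fun v hv hvz => ?_⟩
  · rw [mem_neighborFinset] at hu hv
    exact hG _ _ _ hu huv hv
  · rw [mem_neighborFinset] at hvz
    obtain ⟨w, h1, h2⟩ := hN z v (by rintro rfl; exact hz hv) hvz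
    exact ⟨w, by simpa using h1, h2.symm⟩

/-- The structure behind the lower bound: a core `H` spanning `σ / 2` edges, of size `h`, such that
the vertices outside `H` are only joined to `H`, and `m` of them have degree exactly `t`. -/
theorem exists_core_counts (t : ℕ) (ht : 6 ≤ t) :
    ∃ A C : ℕ, ∀ (V : Type) [Fintype V] (G : SimpleGraph V),
      TriangleFree G → CommonNbr G → MinDegGe G t → TwinCond G t →
      ∃ σ h m : ℕ, (2 * t + 2) * h ≤ σ + A ∧
        σ + 2 * (t + 1) * Fintype.card V ≤ 2 * G.edgeSet.ncard + 2 * (t + 1) * h + 2 * m ∧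
        σ + 2 * t * Fintype.card V ≤ 2 * G.edgeSet.ncard + 2 * t * h ∧
        m ≤ C * (Nat.sqrt σ + 1) ^ (t - 3) := by
  obtain ⟨C₀, hcore⟩ := exists_core (2 * t + 2) t (2 * t + 2)
  obtain ⟨s, rfl⟩ : ∃ s, t = s + 6 := ⟨t - 6, by omega⟩
  obtain ⟨C, hC⟩ := exists_card_maxIndep_le (s + 1)
  set t := s + 6 with ht_def
  refine ⟨(2 * t + 2) * C₀, t * (t * C), fun V _ G hG hN hM hT => ?_⟩
  obtain ⟨X, hXc, hX1, hX2⟩ := hcore V G hG hN ∅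
    (Finset.univ.filter fun v => (G.neighborFinset v).card < 2 * t + 2)
    (fun w hw => ⟨(Finset.mem_filter.1 hw).2, by simp⟩) (by simp)
  set H := (Finset.univ.filter fun v => 2 * t + 2 ≤ (G.neighborFinset v).card) ∪ X with hHdef
  have hXH : X ⊆ H := Finset.subset_union_right
  have mem_H : ∀ v, v ∉ H → (G.neighborFinset v).card < 2 * t + 2 ∧ v ∉ X := by
    intro v hv
    simp only [hHdef, Finset.mem_union, Finset.mem_filter, Finset.mem_univ, true_and, not_or,
      not_le] at hv
    exact hv
  have hind : ∀ z, z ∉ H → ∀ y, G.Adj z y → y ∈ H := by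
    intro z hz y hzy
    obtain ⟨h1, h2⟩ := mem_H z hz
    have := hX1 z (Finset.mem_filter.2 ⟨Finset.mem_univ _, h1⟩) h2 y hzy
    exact Finset.mem_union_left _ (Finset.mem_filter.2 ⟨Finset.mem_univ _, this⟩)
  have hdegB : ∀ b ∈ H, b ∉ X → t + 1 ≤ degOn G X b ∨ 2 * t + 2 ≤ degOn G H b := by
    intro b hb hbX
    refine (hX2 b hbX).imp_right fun hno => ?_
    have hbd : 2 * t + 2 ≤ (G.neighborFinset b).card := by
      rcases Finset.mem_union.1 hb with h | h
      · exact (Finset.mem_filter.1 h).2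
      · exact absurd h hbX
    rwa [degOn_eq_card_of_subset]
    intro y hby
    by_contra hy
    obtain ⟨h1, h2⟩ := mem_H y hy
    exact hno y (Finset.mem_filter.2 ⟨Finset.mem_univ _, h1⟩) h2 hby
  have hcard := card_mul_le_sum_degOn hXH t hdegB
  have hedges := two_mul_edges_eq hind
  set σ := ∑ h ∈ H, degOn G H h with hσ
  set M := Hᶜ.filter fun z => (G.neighborFinset z).card = t with hMdef
  have hmin : ∀ v, t ≤ (G.neighborFinset v).card := by
    intro v
    have := hM v
    rwa [← coe_neighborFinset, Set.ncard_coe_finset] at this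
  have hcompl : H.card + Hᶜ.card = Fintype.card V := Finset.card_add_card_compl H
  have hsum1 : Hᶜ.card * t ≤ ∑ z ∈ Hᶜ, (G.neighborFinset z).card := by
    rw [← smul_eq_mul, ← Finset.sum_const]
    exact Finset.sum_le_sum fun z _ => hmin z
  have hsum2 : Hᶜ.card * (t + 1) ≤ ∑ z ∈ Hᶜ, (G.neighborFinset z).card + M.card := by
    rw [hMdef, Finset.card_filter, ← Finset.sum_add_distrib, ← smul_eq_mul, ← Finset.sum_const]
    refine Finset.sum_le_sum fun z _ => ?_
    have := hmin z
    split_ifs <;> omega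
  refine ⟨σ, H.card, M.card, hcard.trans ?_, ?_, ?_, ?_⟩
  · gcongr
  · rw [hedges, ← hcompl]; nlinarith
  · rw [hedges, ← hcompl]; nlinarith
  · set F := M.image fun z => G.neighborFinset z with hF
    have hMem : ∀ z ∈ M, z ∉ H ∧ (G.neighborFinset z).card = t := by
      intro z hz
      rw [hMdef, Finset.mem_filter, Finset.mem_compl] at hz
      exact hz
    have hFsub : F ⊆ maxIndep G H (s + 5 + 1) := by
      intro S hS
      obtain ⟨z, hz, rfl⟩ := Finset.mem_image.1 hS
      exact neighborFinset_mem_maxIndep hG hN (hMem z hz).1 (hind z (hMem z hz).1) (hMem z hz).2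
    have hFcard : F.card ≤ t * C * (Nat.sqrt σ + 1) ^ (s + 3) := by
      rcases F.eq_empty_or_nonempty with h0 | ⟨S₀, hS₀⟩
      · simp [h0]
      · obtain ⟨z₀, hz₀, rfl⟩ := Finset.mem_image.1 hS₀
        refine (card_le_sum_maxIndep hFsub (G.neighborFinset z₀) ?_).trans ?_
        · intro S hS
          obtain ⟨z, hz, rfl⟩ := Finset.mem_image.1 hS
          by_cases hzz : z₀ = z
          · subst hzz
            have h1 : 0 < (G.neighborFinset z₀).card := by rw [(hMem z₀ hz₀).2]; omega
            obtain ⟨a, ha⟩ := Finset.card_pos.1 h1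
            exact ⟨a, ha, ha⟩
          · obtain ⟨w, h1, h2⟩ := hN z₀ z hzz fun hadj =>
              (hMem z hz).1 (hind z₀ (hMem z₀ hz₀).1 z hadj)
            exact ⟨w, by simpa using h1, by simpa using h2⟩
        · have hq : σ ≤ (Nat.sqrt σ + 1) ^ 2 := by
            rw [sq]; exact (Nat.lt_succ_sqrt σ).le
          refine (Finset.sum_le_sum fun v _ => hC V G hG (nonNbr G H v) (Nat.sqrt σ + 1) (by omega)
            ((sum_degOn_mono (nonNbr_subset v)).trans hq)).trans ?_
          rw [Finset.sum_const, smul_eq_mul, (hMem z₀ hz₀).2, mul_assoc]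
    calc M.card ≤ t * F.card := card_le_mul_card_nbrs (by omega) hT M
      _ ≤ t * (t * C * (Nat.sqrt σ + 1) ^ (s + 3)) := by gcongr
      _ = t * (t * C) * (Nat.sqrt σ + 1) ^ (t - 3) := by
          rw [mul_assoc, mul_assoc, mul_assoc]; rfl

/-- The surplus of `e` over `T * n` is at least of order `n ^ (2 / k)`. -/
theorem rpow_le_of_counts {T A C σ h m n e : ℝ} {k : ℕ} (hk : 2 ≤ k) (hT : 0 ≤ T) (hA : 0 ≤ A)
    (hC : 0 ≤ C) (hσ : 0 ≤ σ) (hn : 0 ≤ n) (h1 : (2 * T + 2) * h ≤ σ + A)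
    (h2 : σ + 2 * (T + 1) * n ≤ 2 * e + 2 * (T + 1) * h + 2 * m)
    (h3 : σ + 2 * T * n ≤ 2 * e + 2 * T * h) (h4 : m ≤ C * (√σ + 1) ^ k) :
    n ^ ((2 : ℝ) / k) ≤
      (2 + A + C * (√(2 * (T + 1)) + 1) ^ k) ^ 2 * (e - T * n + A + 1) := by
  obtain ⟨D, hD⟩ : ∃ D, D = e - T * n + A + 1 := ⟨_, rfl⟩
  obtain ⟨B, hB⟩ : ∃ B, B = √(2 * (T + 1)) + 1 := ⟨_, rfl⟩
  obtain ⟨Γ, hΓ⟩ : ∃ Γ, Γ = 2 + A + C * B ^ k := ⟨_, rfl⟩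
  rw [← hB, ← hΓ, ← hD]
  have hB1 : 1 ≤ B := by rw [hB]; linarith [Real.sqrt_nonneg (2 * (T + 1))]
  have hCB : 0 ≤ C * B ^ k := by positivity
  have hΓ1 : 1 ≤ Γ := by linarith
  have hTA : 0 ≤ T * A := mul_nonneg hT hA
  have hsurplus : σ ≤ 2 * (T + 1) * (e - T * n) + T * A := by
    have k1 := mul_le_mul_of_nonneg_left h1 hT
    have k2 := mul_le_mul_of_nonneg_left h3 (show 0 ≤ T + 1 by linarith)
    linarith
  have hσD : σ ≤ 2 * (T + 1) * D := by rw [hD]; linarith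
  have hD1 : 1 ≤ D := by
    have : 0 ≤ (T + 1) * (D - 1) := by rw [hD]; linarith
    linarith [nonneg_of_mul_nonneg_right this (by linarith)]
  have hnD : n ≤ D + A + m := by rw [hD]; linarith
  obtain ⟨r, hr⟩ : ∃ r, r = √D := ⟨_, rfl⟩
  have hr1 : 1 ≤ r := by rw [hr]; exact Real.one_le_sqrt.2 hD1
  have hr2 : r ^ 2 = D := by rw [hr]; exact Real.sq_sqrt (by linarith)
  have hsq : √σ + 1 ≤ B * r := by
    have k1 : √σ ≤ √(2 * (T + 1)) * r := by
      rw [hr, ← Real.sqrt_mul (by linarith)]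
      exact Real.sqrt_le_sqrt hσD
    rw [hB]; linarith
  have hDr : D ≤ r ^ k := by rw [← hr2]; exact pow_le_pow_right₀ hr1 hk
  have hnr : n ≤ (Γ * r) ^ k := by
    have k1 : m ≤ C * B ^ k * r ^ k := by
      refine h4.trans ?_
      rw [mul_assoc, ← mul_pow]
      gcongr
    have k2 : A * 1 ≤ A * r ^ k := mul_le_mul_of_nonneg_left (one_le_pow₀ hr1) hA
    have k3 : n ≤ Γ * r ^ k := by
      rw [hΓ]; linarith
    rw [mul_pow]
    refine k3.trans ?_
    gcongr
    exact le_self_pow₀ hΓ1 (by omega)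
  calc n ^ ((2 : ℝ) / k) ≤ ((Γ * r) ^ k) ^ ((2 : ℝ) / k) :=
        Real.rpow_le_rpow hn hnr (by positivity)
    _ = (Γ * r) ^ 2 := by
        rw [← Real.rpow_natCast, ← Real.rpow_mul (by positivity),
          mul_div_cancel₀ _ (by positivity), Real.rpow_ofNat]
    _ = Γ ^ 2 * D := by rw [mul_pow, hr2]

/-- The lower bound on the number of edges. -/
theorem exists_lower_bound (t : ℕ) (ht : 6 ≤ t) :
    ∃ c : ℝ, 0 < c ∧ ∃ N : ℕ, ∀ n : ℕ, N ≤ n →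
      ∀ (V : Type) [Fintype V] (G : SimpleGraph V), Fintype.card V = n →
        Ksat 3 G → MinDegGe G t → TwinCond G t →
        (t : ℝ) * n + c * (n : ℝ) ^ ((2 : ℝ) / ((t : ℝ) - 3)) ≤ (G.edgeSet.ncard : ℝ) := by
  obtain ⟨A, C, hAC⟩ := exists_core_counts t ht
  have hcast : ((t - 3 : ℕ) : ℝ) = (t : ℝ) - 3 := by
    rw [Nat.cast_sub (by omega), Nat.cast_ofNat]
  rw [← hcast]
  obtain ⟨Γ, hΓ⟩ : ∃ Γ : ℝ, Γ = (2 + A + C * (√(2 * (t + 1)) + 1) ^ (t - 3)) ^ 2 := ⟨_, rfl⟩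
  have hΓ0 : 0 < Γ := by rw [hΓ]; positivity
  have hα : (0 : ℝ) < 2 / (t - 3 : ℕ) := by
    have : 0 < t - 3 := by omega
    positivity
  have hev : ∀ᶠ n : ℕ in Filter.atTop, 2 * Γ * (A + 1) ≤ (n : ℝ) ^ ((2 : ℝ) / (t - 3 : ℕ)) :=
    ((tendsto_rpow_atTop hα).comp tendsto_natCast_atTop_atTop).eventually_ge_atTop _
  obtain ⟨N, hN⟩ := Filter.eventually_atTop.1 hev
  refine ⟨1 / (2 * Γ), by positivity, N, fun n hn V _ G hcard hK hM hT => ?_⟩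
  obtain ⟨hG, hC⟩ := (ksat_three_iff G).1 hK
  obtain ⟨σ, h, m, h1, h2, h3, h4⟩ := hAC V G hG hC hM hT
  rw [hcard] at h2 h3
  have e4 : (m : ℝ) ≤ C * (√σ + 1) ^ (t - 3) := by
    have : (m : ℝ) ≤ C * ((Nat.sqrt σ : ℝ) + 1) ^ (t - 3) := by exact_mod_cast h4
    refine this.trans ?_
    gcongr
    exact Real.nat_sqrt_le_real_sqrt
  have key := rpow_le_of_counts (T := t) (A := A) (C := C) (σ := σ) (h := h) (m := m) (n := n)
    (e := (G.edgeSet.ncard : ℝ)) (k := t - 3) (by omega) (by positivity) (by positivity)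
    (by positivity) (by positivity) (by positivity) (by exact_mod_cast h1) (by exact_mod_cast h2)
    (by exact_mod_cast h3) e4
  rw [← hΓ] at key
  have hlarge := hN n hn
  have : 1 / (2 * Γ) * (n : ℝ) ^ ((2 : ℝ) / (t - 3 : ℕ)) ≤ G.edgeSet.ncard - t * n := by
    rw [div_mul_eq_mul_div, one_mul, div_le_iff₀ (by positivity)]
    linarith
  linarith

end LowerBound

section Construction

variable {b q : ℕ}

/-- A core vertex `(i, p, p')` stands for the condition that a function `z : ZMod b → Fin (q + 1)`
takes the values `p` at `i` and `p'` at `i + 1`. -/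
abbrev Core (b q : ℕ) : Type := ZMod b × Fin (q + 1) × Fin (q + 1)

/-- `z` satisfies the condition `u`. -/
def Selects (z : ZMod b → Fin (q + 1)) (u : Core b q) : Prop :=
  z u.1 = u.2.1 ∧ z (u.1 + 1) = u.2.2

/-- `u` and `v` are contradictory conditions at consecutive places. -/
def Conflict (u v : Core b q) : Prop := v.1 = u.1 + 1 ∧ u.2.2 ≠ v.2.1

/-- The adjacency relation of `selectionGraph`. -/
def SelAdj (Z : Finset (ZMod b → Fin (q + 1))) :
    Option (Core b q ⊕ Z) → Option (Core b q ⊕ Z) → Prop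
  | none, some (Sum.inr _) => True
  | some (Sum.inr _), none => True
  | some (Sum.inl u), some (Sum.inl v) => u.1 ≠ v.1 ∧ (Conflict u v ∨ Conflict v u)
  | some (Sum.inl u), some (Sum.inr z) => Selects z.1 u
  | some (Sum.inr z), some (Sum.inl u) => Selects z.1 u
  | _, _ => False

/-- The graph on the core vertices, the functions in `Z`, and one more vertex joined to all of `Z`.
Core vertices are joined when they conflict, and `z ∈ Z` is joined to the core vertices it
selects. -/
def selectionGraph (Z : Finset (ZMod b → Fin (q + 1))) : SimpleGraph (Option (Core b q ⊕ Z)) where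
  Adj := SelAdj Z
  symm := ⟨by
    rintro (_ | u | z) (_ | v | z') h <;> simp only [SelAdj] at h ⊢
    all_goals first | exact h | exact ⟨h.1.symm, h.2.symm⟩⟩
  loopless := ⟨by rintro (_ | u | z) h <;> simp [SelAdj] at h⟩

/-- The functions vanishing somewhere. -/
def vanishing (b q : ℕ) [NeZero b] : Finset (ZMod b → Fin (q + 1)) :=
  Finset.univ.filter fun z => ∃ i, z i = 0

theorem card_vanishing_le [NeZero b] : (vanishing b q).card ≤ b * (q + 1) ^ (b - 1) := by
  have h : vanishing b q ⊆ Finset.univ.biUnion fun i : ZMod b =>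
      (Fintype.piFinset fun _ : ZMod b => (Finset.univ : Finset (Fin (q + 1)))).filter
        fun z => z i = 0 := by
    intro z hz
    simpa [vanishing] using hz
  refine (Finset.card_le_card h).trans ((Finset.card_biUnion_le_card_mul _ _
    ((q + 1) ^ (b - 1)) fun i _ => ?_).trans ?_)
  · rw [Fintype.card_filter_piFinset_const_eq_of_mem _ _ (Finset.mem_univ _)]
    simp [ZMod.card]
  · simp [ZMod.card]

theorem natCast_zmod_ne_zero {k : ℕ} (h0 : 0 < k) (hk : k < b) : (k : ZMod b) ≠ 0 := by
  rw [Ne, ZMod.natCast_eq_zero_iff]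
  exact fun h => absurd (Nat.le_of_dvd h0 h) (by omega)

theorem zmod_add_one_ne (hb : 5 ≤ b) (i : ZMod b) : i + 1 ≠ i := fun h => by
  refine natCast_zmod_ne_zero (b := b) (k := 1) (by omega) (by omega) ?_
  simpa using h

variable {Z : Finset (ZMod b → Fin (q + 1))}

theorem adj_core_core {u v : Core b q} :
    (selectionGraph Z).Adj (some (Sum.inl u)) (some (Sum.inl v)) ↔
    u.1 ≠ v.1 ∧ (Conflict u v ∨ Conflict v u) := Iff.rfl

theorem adj_fun_core {u : Core b q} {z : Z} :
    (selectionGraph Z).Adj (some (Sum.inr z)) (some (Sum.inl u)) ↔ Selects z.1 u := Iff.rfl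

theorem adj_fun_none (z : Z) : (selectionGraph Z).Adj (some (Sum.inr z)) none := trivial

theorem adj_none_fun (z : Z) : (selectionGraph Z).Adj none (some (Sum.inr z)) := trivial

theorem not_adj_none_none : ¬ (selectionGraph Z).Adj none none := id

theorem not_adj_none_core {u : Core b q} :
    ¬ (selectionGraph Z).Adj none (some (Sum.inl u)) := id

theorem not_adj_core_none {u : Core b q} :
    ¬ (selectionGraph Z).Adj (some (Sum.inl u)) none := id

theorem adj_core_succ (hb : 5 ≤ b) (u : Core b q) {c : Fin (q + 1)} (d : Fin (q + 1))
    (h : u.2.2 ≠ c) :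
    (selectionGraph Z).Adj (some (Sum.inl u)) (some (Sum.inl (u.1 + 1, c, d))) := by
  have h1 := natCast_zmod_ne_zero (b := b) (k := 1) (by omega) (by omega)
  refine adj_core_core.2 ⟨fun h => h1 ?_, Or.inl ⟨rfl, h⟩⟩
  simpa using h

theorem adj_core_pred (hb : 5 ≤ b) (u : Core b q) {d : Fin (q + 1)} (c : Fin (q + 1))
    (h : d ≠ u.2.1) :
    (selectionGraph Z).Adj (some (Sum.inl u)) (some (Sum.inl (u.1 - 1, c, d))) := by
  refine adj_core_core.2 ⟨fun k => zmod_add_one_ne hb (u.1 - 1) ?_,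
    Or.inr ⟨(sub_add_cancel _ _).symm, h⟩⟩
  rw [sub_add_cancel]
  exact k

theorem selects_self (z : ZMod b → Fin (q + 1)) (i : ZMod b) : Selects z (i, z i, z (i + 1)) :=
  ⟨rfl, rfl⟩

theorem not_conflict_of_selects {z : ZMod b → Fin (q + 1)} {u v : Core b q} (hu : Selects z u)
    (hv : Selects z v) : ¬ Conflict u v := fun h => h.2 (by rw [← hu.2, ← hv.1, h.1])

theorem triangleFree_selectionGraph (hb : 5 ≤ b) : TriangleFree (selectionGraph Z) := by
  have h1 := zmod_add_one_ne hb
  have h3 := natCast_zmod_ne_zero (b := b) (k := 3) (by omega) (by omega)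
  push_cast at h3
  rintro (_ | u | z) (_ | v | z') (_ | w | z'') huv hvw huw <;>
    first
    | exact huv.elim | exact huw.elim | exact hvw.elim
    | skip
  · rw [adj_core_core] at huv huw hvw
    unfold Conflict at huv huw hvw
    grind
  · exact huv.2.elim (not_conflict_of_selects huw hvw) (not_conflict_of_selects hvw huw)
  · exact huw.2.elim (not_conflict_of_selects huv hvw) (not_conflict_of_selects hvw huv)
  · exact hvw.2.elim (not_conflict_of_selects huv huw) (not_conflict_of_selects huw huv)

/-- Two conditions that do not conflict at distinct places are satisfied by a function vanishing
somewhere. -/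
theorem exists_selects [NeZero b] (hb : 5 ≤ b) {u v : Core b q} (huv : u.1 ≠ v.1)
    (h1 : ¬ Conflict u v) (h2 : ¬ Conflict v u) :
    ∃ z ∈ vanishing b q, Selects z u ∧ Selects z v := by
  obtain ⟨k, hk⟩ : ∃ k, k ∉ ({u.1, u.1 + 1, v.1, v.1 + 1} : Finset (ZMod b)) := by
    by_contra! h
    have h4 := (Finset.card_le_card fun k (_ : k ∈ Finset.univ) => h k).trans Finset.card_le_four
    rw [Finset.card_univ, ZMod.card] at h4
    omega
  simp only [Finset.mem_insert, Finset.mem_singleton, not_or] at hk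
  unfold Conflict at h1 h2
  refine ⟨fun i => if i = u.1 then u.2.1 else if i = u.1 + 1 then u.2.2 else
    if i = v.1 then v.2.1 else if i = v.1 + 1 then v.2.2 else 0, ?_, ?_⟩
  · simp only [vanishing, Finset.mem_filter, Finset.mem_univ, true_and]
    exact ⟨k, by simp [hk]⟩
  · have h0 := zmod_add_one_ne hb
    unfold Selects
    grind

theorem exists_ne_ne (hq : 2 ≤ q) (c d : Fin (q + 1)) : ∃ e, c ≠ e ∧ d ≠ e := by
  obtain ⟨e, he⟩ : ∃ e, e ∉ ({c, d} : Finset (Fin (q + 1))) := by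
    by_contra! h
    have h2 := (Finset.card_le_card fun k (_ : k ∈ Finset.univ) => h k).trans Finset.card_le_two
    rw [Finset.card_univ, Fintype.card_fin] at h2
    omega
  simp only [Finset.mem_insert, Finset.mem_singleton, not_or] at he
  exact ⟨e, Ne.symm he.1, Ne.symm he.2⟩

theorem exists_selects_one [NeZero b] (hb : 5 ≤ b) (u : Core b q) :
    ∃ z ∈ vanishing b q, Selects z u := by
  have h2 := natCast_zmod_ne_zero (b := b) (k := 2) (by omega) (by omega)
  push_cast at h2
  obtain ⟨z, hz, h, -⟩ := exists_selects hb (u := u) (v := (u.1 + 1, u.2.2, 0))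
    (zmod_add_one_ne hb u.1).symm (fun h => h.2 rfl) (fun ⟨h, _⟩ => h2 (by linear_combination -h))
  exact ⟨z, hz, h⟩

theorem commonNbr_core_fun (hb : 5 ≤ b) {u : Core b q} {z : Z}
    (h : ¬ Selects z.1 u) : ∃ w, (selectionGraph Z).Adj (some (Sum.inl u)) w ∧
      (selectionGraph Z).Adj (some (Sum.inr z)) w := by
  by_cases hp : z.1 u.1 = u.2.1
  · exact ⟨_, adj_core_succ hb u _ fun hq => h ⟨hp, hq.symm⟩, adj_fun_core.2 (selects_self _ _)⟩
  · refine ⟨_, adj_core_pred hb u (z.1 (u.1 - 1)) hp, adj_fun_core.2 ⟨rfl, ?_⟩⟩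
    exact congrArg z.1 (sub_add_cancel _ _)

theorem commonNbr_selectionGraph [NeZero b] (hb : 5 ≤ b) (hq : 2 ≤ q) (hZ : vanishing b q ⊆ Z) :
    CommonNbr (selectionGraph Z) := by
  rintro (_ | u | z) (_ | v | z') hne hadj
  · exact absurd rfl hne
  · obtain ⟨z, hz, h⟩ := exists_selects_one hb v
    exact ⟨some (Sum.inr ⟨z, hZ hz⟩), adj_none_fun _, h⟩
  · exact absurd (adj_none_fun _) hadj
  · obtain ⟨z, hz, h⟩ := exists_selects_one hb u
    exact ⟨some (Sum.inr ⟨z, hZ hz⟩), h, adj_none_fun _⟩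
  · by_cases huv : u.1 = v.1
    · obtain ⟨e, h1, h2⟩ := exists_ne_ne hq u.2.2 v.2.2
      refine ⟨_, adj_core_succ hb u 0 h1, ?_⟩
      rw [huv]
      exact adj_core_succ hb v 0 h2
    · rw [adj_core_core, not_and_or, not_or] at hadj
      obtain ⟨h1, h2⟩ := hadj.resolve_left (not_not_intro huv)
      obtain ⟨z, hz, h⟩ := exists_selects hb huv h1 h2
      exact ⟨some (Sum.inr ⟨z, hZ hz⟩), h⟩
  · exact commonNbr_core_fun hb hadj
  · exact absurd (adj_fun_none _) hadj
  · obtain ⟨w, h1, h2⟩ := commonNbr_core_fun hb hadj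
    exact ⟨w, h2, h1⟩
  · exact ⟨none, adj_fun_none _, adj_fun_none _⟩

theorem twinFree_selectionGraph (hb : 5 ≤ b) (hq : 2 ≤ q) : TwinFree (selectionGraph Z) := by
  intro u v h
  have hiff : ∀ w, (selectionGraph Z).Adj u w ↔ (selectionGraph Z).Adj v w := fun w =>
    Set.ext_iff.1 h w
  have core_none : ∀ u : Core b q, ¬ ∀ w, (selectionGraph Z).Adj (some (Sum.inl u)) w ↔
      (selectionGraph Z).Adj none w := fun u hu => by
    obtain ⟨e, h1, -⟩ := exists_ne_ne hq u.2.2 0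
    exact not_adj_none_core ((hu _).1 (adj_core_succ hb u 0 h1))
  rcases u with _ | u | z <;> rcases v with _ | v | z'
  · rfl
  · exact absurd (fun w => (hiff w).symm) (core_none v)
  · exact absurd ((hiff none).2 (adj_fun_none _)) not_adj_none_none
  · exact absurd hiff (core_none u)
  · obtain ⟨e, he, -⟩ := exists_ne_ne hq u.2.2 0
    obtain ⟨d, hd, -⟩ := exists_ne_ne hq u.2.1 0
    have h2 := natCast_zmod_ne_zero (b := b) (k := 2) (by omega) (by omega)
    have h4 := natCast_zmod_ne_zero (b := b) (k := 4) (by omega) (by omega)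
    push_cast at h2 h4
    have huv : u.1 = v.1 := by
      rcases (adj_core_core.1 ((hiff _).1 (adj_core_succ hb u 0 he))).2 with ⟨k1, -⟩ | ⟨k1, -⟩
      · linear_combination k1
      · rcases (adj_core_core.1 ((hiff _).1 (adj_core_pred hb u 0 hd.symm))).2 with
          ⟨k2, -⟩ | ⟨k2, -⟩
        · exact absurd (by linear_combination -k1 - k2) h4
        · linear_combination -k2
    congr 2
    refine Prod.ext huv (Prod.ext ?_ ?_) <;> by_contra hne
    · rcases (adj_core_core.1 ((hiff _).1 (adj_core_pred hb u 0 (Ne.symm hne)))).2 with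
        ⟨k, -⟩ | ⟨-, k⟩
      · exact h2 (by linear_combination -k + huv)
      · exact k rfl
    · rcases (adj_core_core.1 ((hiff _).1 (adj_core_succ hb u 0 hne))).2 with ⟨-, k⟩ | ⟨k, -⟩
      · exact k rfl
      · exact h2 (by linear_combination -k - huv)
  · exact absurd ((hiff none).2 (adj_fun_none _)) not_adj_core_none
  · exact absurd ((hiff none).1 (adj_fun_none _)) not_adj_none_none
  · exact absurd ((hiff none).1 (adj_fun_none _)) not_adj_core_none
  · congr 2
    ext1
    funext i
    exact (adj_fun_core.1 ((hiff _).1 (adj_fun_core.2 (selects_self z.1 i)))).1.symm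

theorem card_le_ncard_neighborSet {W ι : Type*} [Finite W] [Fintype ι] {G : SimpleGraph W} {w : W}
    (f : ι → W) (hf : Function.Injective f) (h : ∀ i, G.Adj w (f i)) :
    Fintype.card ι ≤ (G.neighborSet w).ncard := by
  rw [← Nat.card_eq_fintype_card, ← Set.ncard_range_of_injective hf]
  exact Set.ncard_le_ncard (Set.range_subset_iff.2 h)

theorem minDegGe_selectionGraph [NeZero b] (hb : 5 ≤ b) (hq : b ≤ q) (hZ : vanishing b q ⊆ Z) :
    MinDegGe (selectionGraph Z) (b + 1) := by
  have hcard : Fintype.card (Fin (q + 1)) = q + 1 := Fintype.card_fin _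
  rintro (_ | u | z)
  · have hmem : ∀ d : Fin (q + 1), (fun k : ZMod b => if k = 0 then d else 0) ∈ Z := fun d => hZ <|
      Finset.mem_filter.2 ⟨Finset.mem_univ _, 0 + 1, if_neg (zmod_add_one_ne hb 0)⟩
    refine le_trans (by omega) (card_le_ncard_neighborSet
      (fun d : Fin (q + 1) => some (Sum.inr ⟨_, hmem d⟩)) (fun d d' h => ?_)
      fun d => adj_none_fun _)
    simpa using congrFun (congrArg Subtype.val (Sum.inr.inj (Option.some.inj h))) 0
  · obtain ⟨e, he, -⟩ := exists_ne_ne (by omega) u.2.2 0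
    refine le_trans (by omega) (card_le_ncard_neighborSet _ (fun d d' h => ?_)
      fun d : Fin (q + 1) => adj_core_succ hb u d he)
    simpa using h
  · refine le_trans ?_ (card_le_ncard_neighborSet (fun i : Option (ZMod b) =>
      i.map fun i => Sum.inl (i, z.1 i, z.1 (i + 1))) (Option.map_injective fun i j h => ?_) ?_)
    · rw [Fintype.card_option, ZMod.card]
    · simpa using congrArg Prod.fst (Sum.inl.inj h)
    · rintro (_ | i)
      · exact adj_fun_none _
      · exact adj_fun_core.2 (selects_self _ _)

theorem ncard_edgeSet_selectionGraph_le [NeZero b] :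
    (selectionGraph Z).edgeSet.ncard ≤ (b + 1) * Z.card + b * (q + 1) ^ 4 := by
  let f : (Option (ZMod b) × Z) ⊕ (Core b q × Fin (q + 1) × Fin (q + 1)) →
      Sym2 (Option (Core b q ⊕ Z)) :=
    Sum.elim
      (fun w => s(some (Sum.inr w.2), w.1.map fun i => Sum.inl (i, w.2.1 i, w.2.1 (i + 1))))
      (fun w => s(some (Sum.inl w.1), some (Sum.inl (w.1.1 + 1, w.2))))
  have none_mem : ∀ z : Z, s(some (Sum.inr z), none) ∈ Set.range f := fun z =>
    ⟨Sum.inl (none, z), rfl⟩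
  have selects_mem : ∀ (z : Z) (u : Core b q), Selects z.1 u →
      s(some (Sum.inr z), some (Sum.inl u)) ∈ Set.range f := by
    rintro z ⟨i, p, p'⟩ ⟨h1, h2⟩
    refine ⟨Sum.inl (some i, z), ?_⟩
    dsimp only at h1 h2
    subst h1 h2
    rfl
  have conflict_mem : ∀ u v : Core b q, Conflict u v →
      s(some (Sum.inl u), some (Sum.inl v)) ∈ Set.range f := by
    rintro u ⟨j, p, p'⟩ ⟨h1, -⟩
    refine ⟨Sum.inr (u, p, p'), ?_⟩
    dsimp only at h1
    subst h1
    rfl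
  have hsub : (selectionGraph Z).edgeSet ⊆ Set.range f := by
    intro e
    induction e with | _ u v =>
    intro h
    rw [mem_edgeSet] at h
    rcases u with _ | u | z <;> rcases v with _ | v | z'
    · exact h.elim
    · exact h.elim
    · rw [Sym2.eq_swap]; exact none_mem _
    · exact h.elim
    · rcases (adj_core_core.1 h).2 with h | h
      · exact conflict_mem _ _ h
      · rw [Sym2.eq_swap]; exact conflict_mem _ _ h
    · rw [Sym2.eq_swap]; exact selects_mem _ _ h
    · exact none_mem _
    · exact selects_mem _ _ h
    · exact h.elim
  refine (Set.ncard_le_ncard hsub).trans ?_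
  rw [← Set.image_univ]
  refine (Set.ncard_image_le Set.finite_univ).trans ?_
  rw [Set.ncard_univ, Nat.card_eq_fintype_card]
  simp only [Fintype.card_sum, Fintype.card_prod, Fintype.card_option, ZMod.card, Fintype.card_fin,
    Fintype.card_coe]
  exact le_of_eq (by ring)

/-- Transport of a twin-free saturated graph to `Fin n`. -/
theorem exists_fin_of_equiv {W : Type*} {n t : ℕ} (e : Fin n ≃ W) {G : SimpleGraph W}
    (hG : TriangleFree G) (hN : CommonNbr G) (hM : MinDegGe G t) (hT : TwinFree G) :
    ∃ G' : SimpleGraph (Fin n), Ksat 3 G' ∧ MinDegGe G' t ∧ TwinCond G' t ∧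
      G'.edgeSet.ncard = G.edgeSet.ncard := by
  have hset : ∀ v, (G.comap e).neighborSet v = e ⁻¹' G.neighborSet (e v) := fun v => rfl
  refine ⟨G.comap e, (ksat_three_iff _).2 ⟨fun u v w => hG _ _ _, fun u v huv h => ?_⟩,
    fun v => ?_, fun u v huv h => absurd ?_ huv, ?_⟩
  · obtain ⟨w, h1, h2⟩ := hN (e u) (e v) (e.injective.ne huv) h
    exact ⟨e.symm w, by simpa using h1, by simpa using h2⟩
  · rw [hset, Set.ncard_preimage_of_injective_subset_range e.injective (by simp)]
    exact hM _
  · rw [hset, hset] at h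
    exact e.injective (hT _ _ (e.surjective.preimage_injective h))
  · exact Nat.card_congr (Iso.comap e G).mapEdgeSet

theorem exists_pow_lt_le {b n K : ℕ} (hb : b ≠ 0) (hn : K ^ b < n) :
    ∃ q, K ≤ q ∧ q ^ b < n ∧ n ≤ (q + 1) ^ b := by
  have h : ∃ s, n ≤ s ^ b := ⟨n, Nat.le_self_pow hb n⟩
  have hs := Nat.find_spec h
  have hK : K < Nat.find h := by
    by_contra! hle
    exact absurd (hs.trans (Nat.pow_le_pow_left hle b)) (by omega)
  have hlt := Nat.find_min h (m := Nat.find h - 1) (by omega)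
  refine ⟨Nat.find h - 1, by omega, by omega, ?_⟩
  rwa [Nat.sub_add_cancel (by omega)]

/-- The selection graph with a suitable number of functions has few edges. -/
theorem exists_upper_bound {b n q : ℕ} (hb : 5 ≤ b) (hq : b * 2 ^ b ≤ q) (h1 : q ^ b < n)
    (h2 : n ≤ (q + 1) ^ b) :
    ∃ G : SimpleGraph (Fin n), Ksat 3 G ∧ MinDegGe G (b + 1) ∧ TwinCond G (b + 1) ∧
      G.edgeSet.ncard ≤ (b + 1) * n + b * (q + 1) ^ 4 := by
  have : NeZero b := ⟨by omega⟩
  have hbq : b ≤ q := (Nat.le_mul_of_pos_right b (by positivity)).trans hq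
  have hcore : b * (q + 1) ^ 2 + b * (q + 1) ^ (b - 1) ≤ q ^ b := by
    have k1 : (q + 1) ^ 2 ≤ (q + 1) ^ (b - 1) := Nat.pow_le_pow_right (by omega) (by omega)
    have k2 : (q + 1) ^ (b - 1) ≤ (2 * q) ^ (b - 1) := Nat.pow_le_pow_left (by omega) _
    calc b * (q + 1) ^ 2 + b * (q + 1) ^ (b - 1)
        ≤ b * (2 * q) ^ (b - 1) + b * (2 * q) ^ (b - 1) :=
          add_le_add (Nat.mul_le_mul_left _ (k1.trans k2)) (Nat.mul_le_mul_left _ k2)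
      _ = b * (2 ^ (b - 1) * 2) * q ^ (b - 1) := by rw [mul_pow]; ring
      _ = b * 2 ^ b * q ^ (b - 1) := by rw [← pow_succ, Nat.sub_add_cancel (by omega)]
      _ ≤ q * q ^ (b - 1) := by gcongr
      _ = q ^ b := by rw [← pow_succ', Nat.sub_add_cancel (by omega)]
  obtain ⟨Z, hZ, -, hZc⟩ := Finset.exists_subsuperset_card_eq
    (Finset.subset_univ (vanishing b q)) (n := n - 1 - b * (q + 1) ^ 2)
    (card_vanishing_le.trans (by omega))
    (by
      rw [Finset.card_univ, Fintype.card_fun, ZMod.card, Fintype.card_fin]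
      omega)
  have hcard : Fintype.card (Option (Core b q ⊕ Z)) = n := by
    rw [Fintype.card_option, Fintype.card_sum, Fintype.card_coe, hZc, Fintype.card_prod,
      Fintype.card_prod, ZMod.card, Fintype.card_fin, ← sq]
    omega
  obtain ⟨G, hK, hM, hT, he⟩ := exists_fin_of_equiv (Fintype.equivFinOfCardEq hcard).symm
    (triangleFree_selectionGraph (Z := Z) hb) (commonNbr_selectionGraph hb (by omega) hZ)
    (minDegGe_selectionGraph hb hbq hZ) (twinFree_selectionGraph hb (by omega))
  refine ⟨G, hK, hM, hT, he ▸ ncard_edgeSet_selectionGraph_le.trans ?_⟩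
  rw [hZc]
  gcongr
  omega

theorem succ_pow_four_le {b n q : ℕ} (hb : b ≠ 0) (hq : 1 ≤ q) (h : q ^ b < n) :
    ((q : ℝ) + 1) ^ 4 ≤ 16 * (n : ℝ) ^ ((4 : ℝ) / b) := by
  have hq' : (1 : ℝ) ≤ q := by exact_mod_cast hq
  calc ((q : ℝ) + 1) ^ 4 ≤ (2 * q) ^ 4 := by gcongr; linarith
    _ = 16 * ((q : ℝ) ^ b) ^ ((4 : ℝ) / b) := by
        rw [← Real.rpow_natCast _ b, ← Real.rpow_mul (by positivity),
          mul_div_cancel₀ _ (by positivity), Real.rpow_ofNat]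
        ring
    _ ≤ 16 * (n : ℝ) ^ ((4 : ℝ) / b) := by
        gcongr
        exact_mod_cast h.le

end Construction

/-- For `t ≥ 6`:
`tn + Ω(n^{2/(t-3)}) ≤ tsat(n, K_3, t) ≤ tn + O(n^{4/(t-1)})`. -/
theorem stmt4 (t : ℕ) (ht : 6 ≤ t) :
    ∃ c C : ℝ, 0 < c ∧ 0 < C ∧ ∃ N : ℕ, ∀ n : ℕ, N ≤ n →
      (∀ (V : Type) [Fintype V] (G : SimpleGraph V), Fintype.card V = n →
        Ksat 3 G → MinDegGe G t → TwinCond G t →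
        (t : ℝ) * n + c * (n : ℝ) ^ ((2 : ℝ) / ((t : ℝ) - 3)) ≤ (G.edgeSet.ncard : ℝ)) ∧
      (∃ G : SimpleGraph (Fin n), Ksat 3 G ∧ MinDegGe G t ∧ TwinCond G t ∧
        (G.edgeSet.ncard : ℝ) ≤ (t : ℝ) * n + C * (n : ℝ) ^ ((4 : ℝ) / ((t : ℝ) - 1))) := by
  obtain ⟨c, hc, N, hN⟩ := exists_lower_bound t ht
  obtain ⟨b, rfl⟩ : ∃ b, t = b + 1 := ⟨t - 1, by omega⟩
  have hb0 : (0 : ℝ) < b := by exact_mod_cast (by omega : 0 < b)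
  refine ⟨c, b * 16, hc, by positivity, max N ((b * 2 ^ b) ^ b + 1), fun n hn =>
    ⟨hN n (le_of_max_le_left hn), ?_⟩⟩
  obtain ⟨q, hq, h1, h2⟩ := exists_pow_lt_le (b := b) (K := b * 2 ^ b) (by omega)
    (le_of_max_le_right hn)
  obtain ⟨G, hK, hM, hT, he⟩ := exists_upper_bound (by omega) hq h1 h2
  refine ⟨G, hK, hM, hT, ?_⟩
  have hq1 : 1 ≤ q := le_trans (Nat.mul_pos (by omega) (by positivity)) hq
  have he' : (G.edgeSet.ncard : ℝ) ≤ (b + 1) * n + b * ((q : ℝ) + 1) ^ 4 := by exact_mod_cast he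
  refine he'.trans ?_
  push_cast
  rw [add_sub_cancel_right, mul_assoc (b : ℝ)]
  gcongr
  exact succ_pow_four_le (by omega) hq1 h1
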